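/- All 27 lines of the cubic surface S₁ are defined over 𝔽₈: there are exactly 27 two-dimensional 𝔽₈-linear subspaces W of 𝔽₈⁴ such that f₁ vanishes at every vector of W. -/

import Mathlib

open MvPolynomial

/-- The cubic form `Y³ + Y²Z + Z³ + W(X² + Y² + YZ + Z²) + XW² + W³` with the variables
`X, Y, Z, W` indexed by `0, 1, 2, 3`, over any commutative ring (its coefficients lie in `𝔽₂`). -/
noncomputable def f₁ (K : Type*) [CommRing K] : MvPolynomial (Fin 4) K :=
  X 1 ^ 3 + X 1 ^ 2 * X 2 + X 2 ^ 3
    + X 3 * (X 0 ^ 2 + X 1 ^ 2 + X 1 * X 2 + X 2 ^ 2) + X 0 * X 3 ^ 2 + X 3 ^ 3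

section Lines

variable {K : Type*} [Field K]

/-- The line of the plane `W = 0` through `(1, 0, 0, 0)` and `(0, r, 1, 0)`. -/
def lineAtInfinity (r : K) : Submodule K (Fin 4 → K) :=
  Submodule.span K {![1, 0, 0, 0], ![0, r, 1, 0]}

/-- The line through `(p, r, 1, 0)` and `(x, y, 0, 1)`. -/
def affineLine (p r x y : K) : Submodule K (Fin 4 → K) :=
  Submodule.span K {![p, r, 1, 0], ![x, y, 0, 1]}

theorem mem_lineAtInfinity {r : K} {v : Fin 4 → K} :
    v ∈ lineAtInfinity r ↔ v 1 = r * v 2 ∧ v 3 = 0 := by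
  rw [lineAtInfinity, Submodule.mem_span_pair]
  constructor
  · rintro ⟨a, b, rfl⟩
    simp [mul_comm]
  · rintro ⟨h1, h3⟩
    refine ⟨v 0, v 2, ?_⟩
    ext i
    fin_cases i <;> simp [h1, h3, mul_comm]

theorem mem_affineLine {p r x y : K} {v : Fin 4 → K} :
    v ∈ affineLine p r x y ↔ v 0 = p * v 2 + x * v 3 ∧ v 1 = r * v 2 + y * v 3 := by
  rw [affineLine, Submodule.mem_span_pair]
  constructor
  · rintro ⟨a, b, rfl⟩
    simp [mul_comm]
  · rintro ⟨h0, h1⟩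
    refine ⟨v 2, v 3, ?_⟩
    ext i
    fin_cases i <;> simp [h0, h1, mul_comm]

theorem finrank_lineAtInfinity (r : K) : Module.finrank K (lineAtInfinity r) = 2 := by
  have h : LinearIndependent K ![![1, 0, 0, 0], ![0, r, 1, 0]] := by
    rw [LinearIndependent.pair_iff]
    intro s t hst
    have h0 := congrFun hst 0
    have h2 := congrFun hst 2
    simp_all
  rw [lineAtInfinity, ← Matrix.range_cons_cons_empty _ _ ![], finrank_span_eq_card h, Fintype.card_fin]

theorem finrank_affineLine (p r x y : K) : Module.finrank K (affineLine p r x y) = 2 := by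
  have h : LinearIndependent K ![![p, r, 1, 0], ![x, y, 0, 1]] := by
    rw [LinearIndependent.pair_iff]
    intro s t hst
    have h2 := congrFun hst 2
    have h3 := congrFun hst 3
    simp_all
  rw [affineLine, ← Matrix.range_cons_cons_empty _ _ ![], finrank_span_eq_card h, Fintype.card_fin]

theorem lineAtInfinity_injective : Function.Injective (lineAtInfinity (K := K)) := by
  intro r s h
  have hm : ![0, r, 1, 0] ∈ lineAtInfinity s := h ▸ mem_lineAtInfinity.2 (by simp)
  simpa using (mem_lineAtInfinity.1 hm).1

theorem affineLine_inj {p r x y p' r' x' y' : K} :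
    affineLine p r x y = affineLine p' r' x' y' ↔ p = p' ∧ r = r' ∧ x = x' ∧ y = y' := by
  refine ⟨fun h ↦ ?_, by rintro ⟨rfl, rfl, rfl, rfl⟩; rfl⟩
  have h1 : ![p, r, 1, 0] ∈ affineLine p' r' x' y' := h ▸ mem_affineLine.2 (by simp)
  have h2 : ![x, y, 0, 1] ∈ affineLine p' r' x' y' := h ▸ mem_affineLine.2 (by simp)
  rw [mem_affineLine] at h1 h2
  simp_all

theorem lineAtInfinity_ne_affineLine (s p r x y : K) :
    lineAtInfinity s ≠ affineLine p r x y := by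
  intro h
  have hm : ![x, y, 0, 1] ∈ lineAtInfinity s := h ▸ mem_affineLine.2 (by simp)
  simpa using (mem_lineAtInfinity.1 hm).2

theorem eval_f₁ (v : Fin 4 → K) :
    eval v (f₁ K) = v 1 ^ 3 + v 1 ^ 2 * v 2 + v 2 ^ 3
      + v 3 * (v 0 ^ 2 + v 1 ^ 2 + v 1 * v 2 + v 2 ^ 2) + v 0 * v 3 ^ 2 + v 3 ^ 3 := by
  simp [f₁]

theorem f₁_vanishes_on_lineAtInfinity_iff {r : K} :
    (∀ v ∈ lineAtInfinity r, eval v (f₁ K) = 0) ↔ r ^ 3 + r ^ 2 + 1 = 0 := by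
  constructor
  · intro h
    simpa [eval_f₁] using h ![0, r, 1, 0] (mem_lineAtInfinity.2 (by simp))
  · intro h v hv
    obtain ⟨h1, h3⟩ := mem_lineAtInfinity.1 hv
    rw [eval_f₁, h1, h3]
    linear_combination v 2 ^ 3 * h

/-- A plane of `K⁴` on which `(v 2, v 3)` are coordinates is an `affineLine`. -/
theorem exists_eq_affineLine {W : Submodule K (Fin 4 → K)} (hW : Module.finrank K W = 2)
    (hinj : ∀ v ∈ W, v 2 = 0 → v 3 = 0 → v = 0) : ∃ p r x y, W = affineLine p r x y := by
  let φ : W →ₗ[K] (Fin 2 → K) :=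
    LinearMap.pi ![LinearMap.proj 2 ∘ₗ W.subtype, LinearMap.proj 3 ∘ₗ W.subtype]
  have hφ : Function.Injective φ := by
    rw [← LinearMap.ker_eq_bot, LinearMap.ker_eq_bot']
    intro v hv
    exact Subtype.ext (hinj v v.2 (by simpa [φ] using congrFun hv 0)
      (by simpa [φ] using congrFun hv 1))
  have hφ' : Function.Surjective φ :=
    (LinearMap.injective_iff_surjective_of_finrank_eq_finrank (by simp [hW])).1 hφ
  obtain ⟨a, ha⟩ := hφ' ![1, 0]
  obtain ⟨b, hb⟩ := hφ' ![0, 1]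
  have ha2 : a.1 2 = 1 := by simpa [φ] using congrFun ha 0
  have ha3 : a.1 3 = 0 := by simpa [φ] using congrFun ha 1
  have hb2 : b.1 2 = 0 := by simpa [φ] using congrFun hb 0
  have hb3 : b.1 3 = 1 := by simpa [φ] using congrFun hb 1
  refine ⟨a.1 0, a.1 1, b.1 0, b.1 1, (Submodule.eq_of_le_of_finrank_eq ?_ ?_).symm⟩
  · rw [affineLine, Submodule.span_le]
    rintro v (rfl | rfl)
    · refine Set.mem_of_eq_of_mem ?_ a.2
      ext i
      fin_cases i <;> simp [ha2, ha3]
    · refine Set.mem_of_eq_of_mem ?_ b.2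
      ext i
      fin_cases i <;> simp [hb2, hb3]
  · rw [finrank_affineLine, hW]

end Lines

section Card

variable {K : Type*} [Field K] [Finite K]

theorem exists_ne_zero_ne (hK : 2 < Nat.card K) (a : K) : ∃ t : K, t ≠ 0 ∧ t ≠ a := by
  classical
  have := Fintype.ofFinite K
  by_contra! h
  have : (Finset.univ : Finset K) ⊆ {0, a} := fun t _ ↦ by
    by_cases ht : t = 0
    · simp [ht]
    · simp [h t ht]
  have := (Finset.card_le_card this).trans Finset.card_le_two
  rw [Finset.card_univ, ← Nat.card_eq_fintype_card] at this
  omega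

theorem f₁_vanishes_on_affineLine_iff [CharP K 2] (hK : 2 < Nat.card K) {p r x y : K} :
    (∀ v ∈ affineLine p r x y, eval v (f₁ K) = 0) ↔
      r ^ 3 + r ^ 2 + 1 = 0 ∧ r ^ 2 * y + p ^ 2 + r ^ 2 + r + 1 = 0 ∧
        r * y ^ 2 + y ^ 2 + y + p = 0 ∧ y ^ 3 + x ^ 2 + y ^ 2 + x + 1 = 0 := by
  have h2 : (2 : K) = 0 := CharTwo.two_eq_zero
  have key (s t : K) : eval ![s * p + t * x, s * r + t * y, s, t] (f₁ K) =
      s ^ 3 * (r ^ 3 + r ^ 2 + 1) + s ^ 2 * t * (r ^ 2 * y + p ^ 2 + r ^ 2 + r + 1)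
        + s * t ^ 2 * (r * y ^ 2 + y ^ 2 + y + p) + t ^ 3 * (y ^ 3 + x ^ 2 + y ^ 2 + x + 1) := by
    simp only [eval_f₁, Matrix.cons_val]
    linear_combination (s * p * t * x * t + s ^ 2 * r ^ 2 * t * y + s * r * t ^ 2 * y ^ 2
      + s ^ 2 * r * t * y + t ^ 2 * s * r * y) * h2
  constructor
  · intro h
    have hst (s t : K) := (key s t).symm.trans
      (h ![s * p + t * x, s * r + t * y, s, t] (mem_affineLine.2 (by simp [mul_comm])))
    obtain ⟨u, hu0, hu1⟩ := exists_ne_zero_ne hK 1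
    have h10 := hst 1 0
    have h01 := hst 0 1
    have h11 := hst 1 1
    have hu := hst u 1
    simp only [one_pow, zero_pow, ne_eq, OfNat.ofNat_ne_zero, not_false_eq_true, one_mul,
      zero_mul, mul_zero, add_zero, zero_add, mul_one] at h10 h01 h11 hu
    rw [h10, h01] at h11 hu
    have hu1' : u - 1 ≠ 0 := sub_ne_zero.2 hu1
    have hc : r ^ 2 * y + p ^ 2 + r ^ 2 + r + 1 = 0 := by
      apply mul_left_cancel₀ (mul_ne_zero hu0 hu1')
      linear_combination hu - u * h11
    exact ⟨h10, hc, by linear_combination h11 - hc, h01⟩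
  · rintro ⟨h1, h2, h3, h4⟩ v hv
    rw [mem_affineLine] at hv
    have hv' : v = ![v 2 * p + v 3 * x, v 2 * r + v 3 * y, v 2, v 3] := by
      ext i
      fin_cases i <;> simp [hv, mul_comm]
    rw [hv', key, h1, h2, h3, h4]
    simp

/-- In characteristic `2`, a line on the surface is a `lineAtInfinity` or an `affineLine`. -/
theorem exists_eq_line [CharP K 2] (hK : 2 < Nat.card K) {W : Submodule K (Fin 4 → K)}
    (hW : Module.finrank K W = 2) (hf : ∀ v ∈ W, eval v (f₁ K) = 0) :
    (∃ r, W = lineAtInfinity r) ∨ ∃ p r x y, W = affineLine p r x y := by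
  by_cases hinj : ∀ v ∈ W, v 2 = 0 → v 3 = 0 → v = 0
  · exact .inr (exists_eq_affineLine hW hinj)
  left
  push Not at hinj
  obtain ⟨w, hw, hw2, hw3, hw0⟩ := hinj
  have hw1 : w 1 = 0 := by simpa [eval_f₁, hw2, hw3] using hf w hw
  have hw0' : w 0 ≠ 0 := fun h ↦ hw0 (by ext i; fin_cases i <;> simp [*])
  have he : ![1, 0, 0, 0] ∈ W := by
    convert W.smul_mem (w 0)⁻¹ hw
    ext i
    fin_cases i <;> simp [*]
  have h3 : ∀ v ∈ W, v 3 = 0 := by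
    intro v hv
    obtain ⟨t, ht0, ht⟩ := exists_ne_zero_ne hK (v 3)
    have h := hf _ (W.add_mem hv (W.smul_mem t he))
    have h' := hf v hv
    simp only [eval_f₁, Pi.add_apply, Pi.smul_apply, Matrix.cons_val, smul_eq_mul, mul_one,
      mul_zero, add_zero] at h h'
    have h2 : (2 : K) = 0 := CharTwo.two_eq_zero
    have : v 3 * (t * (t - v 3)) = 0 := by
      linear_combination h - h' - (v 3 * v 0 * t + t * v 3 ^ 2) * h2
    simpa [ht0, sub_eq_zero, ht] using this
  obtain ⟨v, hv, hv'⟩ : ∃ v ∈ W, v ∉ Submodule.span K {![(1 : K), 0, 0, 0]} := by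
    by_contra! h
    have := (Submodule.finrank_mono (show W ≤ _ from h)).trans (finrank_span_le_card _)
    simp [hW] at this
  have hv3 := h3 v hv
  have hv2 : v 2 ≠ 0 := by
    intro hv2
    have hv1 : v 1 = 0 := by simpa [eval_f₁, hv2, hv3] using hf v hv
    refine hv' (Submodule.mem_span_singleton.2 ⟨v 0, ?_⟩)
    ext i
    fin_cases i <;> simp [*]
  refine ⟨v 1 / v 2, (Submodule.eq_of_le_of_finrank_eq ?_ ?_).symm⟩
  · rw [lineAtInfinity, Submodule.span_le]
    rintro u (rfl | rfl)
    · exact he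
    · refine Set.mem_of_eq_of_mem ?_ (W.smul_mem (v 2)⁻¹ (W.sub_mem hv (W.smul_mem (v 0) he)))
      ext i
      simp only [Pi.smul_apply, Pi.sub_apply]
      fin_cases i <;> simp [hv3, hv2, div_eq_inv_mul]
  · rw [finrank_lineAtInfinity, hW]

end Card

section Parameters

variable {K : Type*} [Field K] [CharP K 2]

theorem affineLine_equations_iff {p r x y : K} (hr : r ^ 3 + r ^ 2 + 1 = 0) :
    (r ^ 2 * y + p ^ 2 + r ^ 2 + r + 1 = 0 ∧ r * y ^ 2 + y ^ 2 + y + p = 0 ∧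
        y ^ 3 + x ^ 2 + y ^ 2 + x + 1 = 0) ↔
      y = (r + 1) * p ^ 2 + r ^ 2 ∧ (p = 0 ∨ p = 1 ∨ p = r ∨ p = r + 1) ∧
        y ^ 3 + x ^ 2 + y ^ 2 + x + 1 = 0 := by
  have h2 : (2 : K) = 0 := CharTwo.two_eq_zero
  rw [← and_assoc, ← and_assoc]
  refine and_congr_left fun _ ↦ ⟨?_, ?_⟩
  · rintro ⟨h, h'⟩
    have hy : y = (r + 1) * p ^ 2 + r ^ 2 := by grind
    refine ⟨hy, ?_⟩
    have : p * ((p - 1) * ((p - r) * (p - (r + 1)))) = 0 := by grind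
    simpa [sub_eq_zero] using this
  · rintro ⟨rfl, rfl | rfl | rfl | rfl⟩ <;> constructor <;> grind

variable [Fintype K] [DecidableEq K]

/-- The roots of `T³ + T² + 1` in `K`. -/
def cubicRoots (K : Type*) [Field K] [Fintype K] [DecidableEq K] : Finset K :=
  {r | r ^ 3 + r ^ 2 + 1 = 0}

/-- The values of `x` for which `affineLine p r x ((r + 1) * p ^ 2 + r ^ 2)` lies on the surface. -/
def affineLineRoots (r p : K) : Finset K :=
  {x | ((r + 1) * p ^ 2 + r ^ 2) ^ 3 + x ^ 2 + ((r + 1) * p ^ 2 + r ^ 2) ^ 2 + x + 1 = 0}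

/-- The parameters `(r, p, x)` of the affine lines on the surface. -/
def affineLineParameters (K : Type*) [Field K] [Fintype K] [DecidableEq K] :
    Finset (Σ _ : K, Σ _ : K, K) :=
  (cubicRoots K).sigma fun r ↦ ({0, 1, r, r + 1} : Finset K).sigma fun p ↦ affineLineRoots r p

theorem exists_mem_cubicRoots (hK : Fintype.card K = 8) : ∃ r, r ∈ cubicRoots K := by
  have h2 : (2 : K) = 0 := CharTwo.two_eq_zero
  obtain ⟨u, hu0, hu1⟩ := exists_ne_zero_ne (K := K) (by simp [hK]) 1
  have hu : u ^ 8 = u := hK ▸ FiniteField.pow_card u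
  have : u * ((u - 1) * ((u ^ 3 + u + 1) * (u ^ 3 + u ^ 2 + 1))) = 0 := by grind
  simp only [mul_eq_zero, hu0, sub_eq_zero, hu1, false_or] at this
  rcases this with h | h
  · exact ⟨u⁻¹, by simp only [cubicRoots, Finset.mem_filter_univ]; grind⟩
  · exact ⟨u, by simpa [cubicRoots] using h⟩

theorem card_cubicRoots (hK : Fintype.card K = 8) : (cubicRoots K).card = 3 := by
  have h2 : (2 : K) = 0 := CharTwo.two_eq_zero
  obtain ⟨r, hr⟩ := exists_mem_cubicRoots hK
  simp only [cubicRoots, Finset.mem_filter_univ] at hr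
  have : cubicRoots K = {r, r ^ 2, r ^ 2 + r + 1} := by
    ext s
    have : s ^ 3 + s ^ 2 + 1 = (s - r) * ((s - r ^ 2) * (s - (r ^ 2 + r + 1))) := by grind
    simp [cubicRoots, this, sub_eq_zero]
  rw [this, Finset.card_eq_three]
  exact ⟨_, _, _, by grind, by grind, by grind, rfl⟩

theorem card_affineLineRoots {r p : K} (hr : r ∈ cubicRoots K)
    (hp : p ∈ ({0, 1, r, r + 1} : Finset K)) : (affineLineRoots r p).card = 2 := by
  have h2 : (2 : K) = 0 := CharTwo.two_eq_zero
  simp only [cubicRoots, Finset.mem_filter_univ] at hr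
  simp only [Finset.mem_insert, Finset.mem_singleton] at hp
  obtain ⟨a, ha⟩ : ∃ a, ((r + 1) * p ^ 2 + r ^ 2) ^ 3 + a ^ 2
      + ((r + 1) * p ^ 2 + r ^ 2) ^ 2 + a + 1 = 0 := by
    rcases hp with rfl | rfl | rfl | rfl
    · exact ⟨0, by grind⟩
    · exact ⟨0, by grind⟩
    · exact ⟨p ^ 2, by grind⟩
    · exact ⟨r ^ 2 + r, by grind⟩
  have : affineLineRoots r p = {a, a + 1} := by
    ext x
    have : ((r + 1) * p ^ 2 + r ^ 2) ^ 3 + x ^ 2 + ((r + 1) * p ^ 2 + r ^ 2) ^ 2 + x + 1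
        = (x - a) * (x - (a + 1)) := by
      linear_combination ha + (x + a * x - a ^ 2 - a) * h2
    simp [affineLineRoots, this, sub_eq_zero]
  rw [this, Finset.card_pair (by simp)]

theorem card_affineLineParameters (hK : Fintype.card K = 8) :
    (affineLineParameters K).card = 24 := by
  have h2 : (2 : K) = 0 := CharTwo.two_eq_zero
  have hP (r : K) (hr : r ∈ cubicRoots K) :
      (({0, 1, r, r + 1} : Finset K).sigma fun p ↦ affineLineRoots r p).card = 8 := by
    rw [Finset.card_sigma, Finset.sum_congr rfl fun p hp ↦ card_affineLineRoots hr hp]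
    simp only [cubicRoots, Finset.mem_filter_univ] at hr
    have : ({0, 1, r, r + 1} : Finset K).card = 4 := by
      repeat rw [Finset.card_insert_of_notMem (by simp; grind)]
      simp
    simp [this]
  rw [affineLineParameters, Finset.card_sigma, Finset.sum_congr rfl hP]
  simp [card_cubicRoots hK]

theorem setOf_lines_eq (hK : 2 < Fintype.card K) :
    {W : Submodule K (Fin 4 → K) | Module.finrank K W = 2 ∧ ∀ v ∈ W, eval v (f₁ K) = 0} =
      lineAtInfinity '' (cubicRoots K) ∪
        (fun t : Σ _ : K, Σ _ : K, K ↦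
          affineLine t.2.1 t.1 t.2.2 ((t.1 + 1) * t.2.1 ^ 2 + t.1 ^ 2)) ''
            (affineLineParameters K) := by
  rw [← Nat.card_eq_fintype_card] at hK
  ext W
  constructor
  · rintro ⟨hW, hf⟩
    obtain ⟨r, rfl⟩ | ⟨p, r, x, y, rfl⟩ := exists_eq_line hK hW hf
    · exact .inl ⟨r, by simpa [cubicRoots] using f₁_vanishes_on_lineAtInfinity_iff.1 hf, rfl⟩
    · obtain ⟨hr, h⟩ := (f₁_vanishes_on_affineLine_iff hK).1 hf
      obtain ⟨rfl, hp, hx⟩ := (affineLine_equations_iff hr).1 h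
      exact .inr ⟨⟨r, p, x⟩, by
        simpa [affineLineParameters, cubicRoots, affineLineRoots] using ⟨hr, hp, hx⟩, rfl⟩
  · rintro (⟨r, hr, rfl⟩ | ⟨⟨r, p, x⟩, h, rfl⟩)
    · exact ⟨finrank_lineAtInfinity r,
        f₁_vanishes_on_lineAtInfinity_iff.2 (by simpa [cubicRoots] using hr)⟩
    · obtain ⟨hr, hp, hx⟩ : r ^ 3 + r ^ 2 + 1 = 0 ∧ (p = 0 ∨ p = 1 ∨ p = r ∨ p = r + 1) ∧ _ := by
        simpa [affineLineParameters, cubicRoots, affineLineRoots] using h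
      exact ⟨finrank_affineLine .., (f₁_vanishes_on_affineLine_iff hK).2
        ⟨hr, (affineLine_equations_iff hr).2 ⟨rfl, hp, hx⟩⟩⟩

theorem ncard_lines (hK : Fintype.card K = 8) :
    {W : Submodule K (Fin 4 → K) |
      Module.finrank K W = 2 ∧ ∀ v ∈ W, eval v (f₁ K) = 0}.ncard = 27 := by
  rw [setOf_lines_eq (by omega), Set.ncard_union_eq,
    Set.ncard_image_of_injective _ lineAtInfinity_injective, Set.ncard_image_of_injective,
    Set.ncard_coe_finset, Set.ncard_coe_finset, card_cubicRoots hK, card_affineLineParameters hK]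
  · rintro ⟨r, p, x⟩ ⟨r', p', x'⟩ h
    obtain ⟨rfl, rfl, rfl, -⟩ := affineLine_inj.1 h
    rfl
  · rw [Set.disjoint_left]
    rintro _ ⟨s, -, rfl⟩ ⟨t, -, ht⟩
    exact lineAtInfinity_ne_affineLine _ _ _ _ _ ht.symm

end Parameters

/-- All `27` lines of the cubic surface `S₁` are defined over `𝔽₈`: there are exactly `27`
two-dimensional `𝔽₈`-linear subspaces of `𝔽₈⁴` on which `f₁` vanishes identically. -/
theorem S₁_card_lines_over_F8 :
    {W : Submodule (GaloisField 2 3) (Fin 4 → GaloisField 2 3) |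
        Module.finrank (GaloisField 2 3) W = 2
          ∧ ∀ v ∈ W, eval v (f₁ (GaloisField 2 3)) = 0}.ncard = 27 := by
  classical
  have := Fintype.ofFinite (GaloisField 2 3)
  apply ncard_lines
  rw [← Nat.card_eq_fintype_card, GaloisField.card 2 3 (by norm_num)]
  norm_num
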